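/- arXiv:1809.08124 — 2 statements merged into one kernel-verified Lean document; each statement's English description precedes it below -/
import Mathlib

section
/- For every real t > 0 and every natural number m, (∂²Y_ν(t)/∂ν²)|_{ν=m} + (−1)^{m+1}·(∂²Y_ν(t)/∂ν²)|_{ν=−m} = −2π·(∂J_ν(t)/∂ν)|_{ν=m} + π²·Y_m(t). -/
open Real MeasureTheory

/-- Bessel function of the first kind via Schläfli's integral representation. -/
noncomputable def besselJ (ν t : ℝ) : ℝ :=
  (1 / π) * ∫ x in (0:ℝ)..π, Real.cos (t * Real.sin x - ν * x)
    - (Real.sin (ν * π) / π) * ∫ x in Set.Ioi (0:ℝ), Real.exp (-(t * Real.sinh x) - ν * x)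

/-- Bessel function of the second kind via its integral representation. -/
noncomputable def besselY (ν t : ℝ) : ℝ :=
  (1 / π) * ∫ x in (0:ℝ)..π, Real.sin (t * Real.sin x - ν * x)
    - (1 / π) * ∫ x in Set.Ioi (0:ℝ),
        Real.exp (-(t * Real.sinh x)) *
          (Real.exp (ν * x) + Real.exp (-(ν * x)) * Real.cos (ν * π))

open scoped ContDiff

lemma sq_div_four_le_sinh {x : ℝ} (hx : 0 ≤ x) : x ^ 2 / 4 ≤ sinh x := by
  have h₁ := quadratic_le_exp_of_nonneg hx
  have h₂ : exp (-x) ≤ 1 := exp_le_one_iff.2 (by linarith)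
  rw [sinh_eq]
  linarith

lemma integrableOn_exp_neg_mul_sinh_mul_exp {t : ℝ} (ht : 0 < t) (ν : ℝ) :
    IntegrableOn (fun x => exp (-(t * sinh x)) * exp (ν * x)) (Set.Ioi 0) := by
  refine integrable_of_isBigO_exp_neg one_pos (by fun_prop) ?_
  refine Asymptotics.IsBigO.of_bound 1 ?_
  filter_upwards [Filter.eventually_ge_atTop 0,
    Filter.eventually_ge_atTop (4 * (ν + 1) / t)] with x hx₀ hx
  rw [← exp_add, norm_of_nonneg (exp_pos _).le, norm_of_nonneg (exp_pos _).le, one_mul, exp_le_exp]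
  rw [div_le_iff₀ ht] at hx
  nlinarith [mul_le_mul_of_nonneg_left (sq_div_four_le_sinh hx₀) ht.le,
    mul_le_mul_of_nonneg_right hx hx₀]

/-- The Laplace-type integral of `exp (-(t * sinh x))` is a moment generating function, hence
smooth. -/
lemma contDiff_integral_exp_neg_mul_sinh_mul_exp {t : ℝ} (ht : 0 < t) :
    ContDiff ℝ ∞ fun ν => ∫ x in Set.Ioi (0 : ℝ), exp (-(t * sinh x)) * exp (ν * x) := by
  set μ : Measure ℝ := (volume.restrict (Set.Ioi 0)).withDensity
    fun x => ENNReal.ofReal (exp (-(t * sinh x))) with hμ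
  have hmeas : Measurable fun x => ENNReal.ofReal (exp (-(t * sinh x))) := by fun_prop
  have hlt : ∀ᵐ x ∂(volume.restrict (Set.Ioi (0 : ℝ))),
      ENNReal.ofReal (exp (-(t * sinh x))) < ⊤ := by simp
  have hset : ProbabilityTheory.integrableExpSet id μ = Set.univ := by
    refine Set.eq_univ_of_forall fun ν => ?_
    rw [ProbabilityTheory.integrableExpSet, Set.mem_ofPred_eq, hμ,
      integrable_withDensity_iff_integrable_smul' hmeas hlt]
    simpa [(exp_pos _).le, IntegrableOn] using integrableOn_exp_neg_mul_sinh_mul_exp ht ν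
  have hmgf : (fun ν => ∫ x in Set.Ioi (0 : ℝ), exp (-(t * sinh x)) * exp (ν * x))
      = ProbabilityTheory.mgf id μ := by
    ext ν
    rw [ProbabilityTheory.mgf, hμ, integral_withDensity_eq_integral_toReal_smul hmeas hlt]
    simp [(exp_pos _).le]
  rw [hmgf, ← contDiffOn_univ]
  have h := ProbabilityTheory.analyticOn_mgf (X := id) (μ := μ)
  rw [hset, interior_univ] at h
  exact h.contDiffOn uniqueDiffOn_univ

lemma hasDerivAt_integral_mul_cos_sub_mul {g h : ℝ → ℝ} (hg : Continuous g) (hh : Continuous h)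
    (a b ν : ℝ) :
    HasDerivAt (fun ν => ∫ x in a..b, g x * cos (h x - ν * x))
      (∫ x in a..b, (x * g x) * cos (h x - π / 2 - ν * x)) ν := by
  refine (intervalIntegral.hasDerivAt_integral_of_dominated_loc_of_deriv_le
    (F := fun ν x => g x * cos (h x - ν * x))
    (F' := fun ν x => (x * g x) * cos (h x - π / 2 - ν * x))
    (bound := fun x => |x * g x|) Filter.univ_mem ?_ ?_ ?_ ?_ ?_ ?_).2
  · exact .of_forall fun ν => Continuous.aestronglyMeasurable (by fun_prop)
  · exact Continuous.intervalIntegrable (by fun_prop) _ _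
  · exact Continuous.aestronglyMeasurable (by fun_prop)
  · refine .of_forall fun x _ ν _ => ?_
    rw [norm_mul, norm_eq_abs, norm_eq_abs]
    exact mul_le_of_le_one_right (abs_nonneg _) (abs_cos_le_one _)
  · exact Continuous.intervalIntegrable (by fun_prop) _ _
  · refine .of_forall fun x _ ν _ => ?_
    have hd := ((((hasDerivAt_id ν).mul_const x).const_sub (h x)).cos).const_mul (g x)
    refine hd.congr_deriv ?_
    rw [sub_right_comm, cos_sub_pi_div_two]
    simp only [id_eq]
    ring

lemma contDiff_integral_mul_cos_sub_mul {g h : ℝ → ℝ} (hg : Continuous g) (hh : Continuous h)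
    (a b : ℝ) : ContDiff ℝ ∞ fun ν => ∫ x in a..b, g x * cos (h x - ν * x) := by
  refine contDiff_infty.2 fun n => ?_
  induction n generalizing g h with
  | zero =>
    exact contDiff_zero.2 <| continuous_iff_continuousAt.2 fun ν =>
      (hasDerivAt_integral_mul_cos_sub_mul hg hh a b ν).continuousAt
  | succ n ih =>
    have hd := hasDerivAt_integral_mul_cos_sub_mul hg hh a b
    push_cast
    refine contDiff_succ_iff_deriv.2 ⟨fun ν => (hd ν).differentiableAt, by simp, ?_⟩
    rw [funext fun ν => (hd ν).deriv]
    exact ih (by fun_prop) (by fun_prop)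

lemma contDiff_integral_cos_mul_sin_sub_mul (t : ℝ) :
    ContDiff ℝ ∞ fun ν => ∫ x in (0 : ℝ)..π, cos (t * sin x - ν * x) := by
  simpa using contDiff_integral_mul_cos_sub_mul (g := fun _ => 1) (h := fun x => t * sin x)
    (by fun_prop) (by fun_prop) 0 π

lemma contDiff_integral_sin_mul_sin_sub_mul (t : ℝ) :
    ContDiff ℝ ∞ fun ν => ∫ x in (0 : ℝ)..π, sin (t * sin x - ν * x) := by
  simpa [sub_right_comm _ (π / 2), cos_sub_pi_div_two] using
    contDiff_integral_mul_cos_sub_mul (g := fun _ => 1) (h := fun x => t * sin x - π / 2)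
    (by fun_prop) (by fun_prop) 0 π

lemma one_div_pi_mul_integral_sub_const {f : ℝ → ℝ} (hf : Continuous f) (c : ℝ) :
    (1 / π) * (∫ x in (0 : ℝ)..π, (f x - c)) = (1 / π) * (∫ x in (0 : ℝ)..π, f x) - c := by
  rw [intervalIntegral.integral_sub (hf.intervalIntegrable _ _) intervalIntegrable_const,
    intervalIntegral.integral_const, smul_eq_mul, sub_zero]
  field_simp

lemma besselJ_eq (ν t : ℝ) :
    besselJ ν t = (1 / π) * (∫ x in (0 : ℝ)..π, cos (t * sin x - ν * x))
      - (sin (ν * π) / π) * ∫ x in Set.Ioi (0 : ℝ), exp (-(t * sinh x)) * exp (-ν * x) := by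
  rw [besselJ, one_div_pi_mul_integral_sub_const (by fun_prop)]
  simp only [← exp_add, sub_eq_add_neg, neg_mul]

lemma besselY_eq {t : ℝ} (ht : 0 < t) (ν : ℝ) :
    besselY ν t = (1 / π) * (∫ x in (0 : ℝ)..π, sin (t * sin x - ν * x))
      - (1 / π) * ((∫ x in Set.Ioi (0 : ℝ), exp (-(t * sinh x)) * exp (ν * x))
        + cos (ν * π) * ∫ x in Set.Ioi (0 : ℝ), exp (-(t * sinh x)) * exp (-ν * x)) := by
  rw [besselY, one_div_pi_mul_integral_sub_const (by fun_prop), ← integral_const_mul (cos (ν * π)),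
    ← integral_add
    (integrableOn_exp_neg_mul_sinh_mul_exp ht ν)
    ((integrableOn_exp_neg_mul_sinh_mul_exp ht (-ν)).const_mul _)]
  congr! 4 with x
  rw [neg_mul]
  ring

lemma contDiff_besselJ {t : ℝ} (ht : 0 < t) : ContDiff ℝ ∞ fun ν => besselJ ν t := by
  simp only [besselJ_eq]
  have hC := contDiff_integral_cos_mul_sin_sub_mul t
  have hE := (contDiff_integral_exp_neg_mul_sinh_mul_exp ht).comp contDiff_neg
  have hs : ContDiff ℝ ∞ fun ν : ℝ => sin (ν * π) / π := by fun_prop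
  exact (contDiff_const.mul hC).sub (hs.mul hE)

lemma contDiff_besselY {t : ℝ} (ht : 0 < t) : ContDiff ℝ ∞ fun ν => besselY ν t := by
  simp only [besselY_eq ht]
  have hS := contDiff_integral_sin_mul_sin_sub_mul t
  have hE := contDiff_integral_exp_neg_mul_sinh_mul_exp ht
  have hc : ContDiff ℝ ∞ fun ν : ℝ => cos (ν * π) := by fun_prop
  exact (contDiff_const.mul hS).sub
    (contDiff_const.mul (hE.add (hc.mul (hE.comp contDiff_neg))))

lemma integral_sin_mul_sin_add_mul (t ν : ℝ) :
    ∫ x in (0 : ℝ)..π, sin (t * sin x - -ν * x)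
      = sin (ν * π) * (∫ x in (0 : ℝ)..π, cos (t * sin x - ν * x))
        + cos (ν * π) * ∫ x in (0 : ℝ)..π, sin (t * sin x - ν * x) := by
  have h := intervalIntegral.integral_comp_sub_left
    (fun x => sin (t * sin x - -ν * x)) (a := 0) (b := π) π
  rw [sub_self, sub_zero] at h
  rw [← h, ← intervalIntegral.integral_const_mul, ← intervalIntegral.integral_const_mul,
    ← intervalIntegral.integral_add (Continuous.intervalIntegrable (by fun_prop) _ _)
      (Continuous.intervalIntegrable (by fun_prop) _ _)]
  congr! 2 with x
  rw [sin_pi_sub, ← sin_add]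
  congr 1
  ring

/-- The reflection formula for the Bessel function of the second kind. -/
lemma besselY_neg {t : ℝ} (ht : 0 < t) (ν : ℝ) :
    besselY (-ν) t = sin (ν * π) * besselJ ν t + cos (ν * π) * besselY ν t := by
  rw [besselY_eq ht, besselY_eq ht, besselJ_eq, integral_sin_mul_sin_add_mul, neg_neg,
    neg_mul ν π, cos_neg]
  linear_combination (1 / π) * (∫ x in Set.Ioi (0 : ℝ), exp (-(t * sinh x)) * exp (-ν * x)) *
    sin_sq_add_cos_sq (ν * π)

theorem reflection_second_deriv_besselY (t : ℝ) (ht : 0 < t) (m : ℕ) :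
    iteratedDeriv 2 (fun ν : ℝ => besselY ν t) m
      + (-1 : ℝ) ^ (m + 1) * iteratedDeriv 2 (fun ν : ℝ => besselY ν t) (-(m : ℝ))
      = -(2 * π) * deriv (fun ν : ℝ => besselJ ν t) m + π ^ 2 * besselY m t := by
  set J : ℝ → ℝ := fun ν => besselJ ν t
  set Y : ℝ → ℝ := fun ν => besselY ν t
  have hJ₁ (ν : ℝ) : HasDerivAt J (deriv J ν) ν :=
    ((contDiff_besselJ ht).differentiable (by simp) ν).hasDerivAt
  have hY₁ (ν : ℝ) : HasDerivAt Y (deriv Y ν) ν :=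
    ((contDiff_besselY ht).differentiable (by simp) ν).hasDerivAt
  have hJ₂ (ν : ℝ) : HasDerivAt (deriv J) (deriv (deriv J) ν) ν :=
    (((contDiff_infty_iff_deriv.1 (contDiff_besselJ ht)).2).differentiable (by simp) ν).hasDerivAt
  have hY₂ (ν : ℝ) : HasDerivAt (deriv Y) (deriv (deriv Y) ν) ν :=
    (((contDiff_infty_iff_deriv.1 (contDiff_besselY ht)).2).differentiable (by simp) ν).hasDerivAt
  have hs (ν : ℝ) : HasDerivAt (fun ν => sin (ν * π)) (cos (ν * π) * π) ν := by
    simpa using ((hasDerivAt_id ν).mul_const π).sin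
  have hc (ν : ℝ) : HasDerivAt (fun ν => cos (ν * π)) (-sin (ν * π) * π) ν := by
    simpa using ((hasDerivAt_id ν).mul_const π).cos
  have hneg : (fun ν => Y (-ν)) = fun ν => sin (ν * π) * J ν + cos (ν * π) * Y ν :=
    funext (besselY_neg ht)
  have hderiv : deriv (fun ν => Y (-ν)) = fun ν =>
      (cos (ν * π) * π * J ν + sin (ν * π) * deriv J ν)
        + (-sin (ν * π) * π * Y ν + cos (ν * π) * deriv Y ν) := by
    rw [hneg]
    exact funext fun ν => (((hs ν).mul (hJ₁ ν)).add ((hc ν).mul (hY₁ ν))).deriv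
  have hsecond := iteratedDeriv_comp_neg 2 Y (m : ℝ)
  have hd := ((((hc m).mul_const π).fun_mul (hJ₁ m)).fun_add ((hs m).fun_mul (hJ₂ m))).fun_add
    ((((hs m).fun_neg.mul_const π).fun_mul (hY₁ m)).fun_add ((hc m).fun_mul (hY₂ m)))
  rw [iteratedDeriv_succ, iteratedDeriv_one, hderiv, hd.deriv, sin_nat_mul_pi, cos_nat_mul_pi] at hsecond
  have hsq : (-1 : ℝ) ^ m * (-1) ^ m = 1 := by rw [← mul_pow]; simp
  simp only [even_two, Even.neg_pow, one_pow, one_smul] at hsecond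
  rw [← hsecond, iteratedDeriv_succ, iteratedDeriv_one, pow_succ]
  linear_combination (-2 * π * deriv J m - deriv (deriv Y) m + π ^ 2 * Y m) * hsq
end

section
/- For every real t > 0 and every natural number m, (∂I_ν(t)/∂ν)|_{ν=m+1/2} + (∂I_ν(t)/∂ν)|_{ν=−m−1/2} = (2/π)·(−1)^{m+1}·(∂K_ν(t)/∂ν)|_{ν=m+1/2}. -/
open Real MeasureTheory

/-- Modified Bessel function of the first kind via its integral representation. -/
noncomputable def besselI (ν t : ℝ) : ℝ :=
  (1 / π) * ∫ x in (0:ℝ)..π, Real.exp (t * Real.cos x) * Real.cos (ν * x)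
    - (Real.sin (ν * π) / π) * ∫ x in Set.Ioi (0:ℝ), Real.exp (-(t * Real.cosh x) - ν * x)

/-- Modified Bessel function of the second kind (Macdonald function). -/
noncomputable def besselK (ν t : ℝ) : ℝ :=
  (1 / 2) * ∫ x : ℝ, Real.exp (ν * x - t * Real.cosh x)

lemma sq_div_four_le_cosh (x : ℝ) : x ^ 2 / 4 ≤ cosh x := by
  have h := quadratic_le_exp_of_nonneg (abs_nonneg x)
  have h' := exp_pos (-|x|)
  rw [← cosh_abs, cosh_eq, ← sq_abs]
  linarith [abs_nonneg x]

lemma integrable_exp_neg_mul_cosh_sub {t : ℝ} (ht : 0 < t) (ν : ℝ) :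
    Integrable fun x : ℝ => exp (-(t * cosh x) - ν * x) := by
  refine ((integrable_exp_neg_mul_sq (b := t / 8) (by positivity)).const_mul
    (exp (2 * ν ^ 2 / t))).mono' (by fun_prop) (.of_forall fun x => ?_)
  rw [norm_eq_abs, abs_exp, ← exp_add, exp_le_exp]
  have hcosh := mul_le_mul_of_nonneg_left (sq_div_four_le_cosh x) ht.le
  have hsq : 2 * ν ^ 2 / t + ν * x + t * x ^ 2 / 8 = 2 / t * (ν + t * x / 4) ^ 2 := by
    field_simp
    ring
  have hnonneg : 0 ≤ 2 / t * (ν + t * x / 4) ^ 2 := by positivity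
  linarith

lemma differentiable_integral_Ioi_exp_neg_mul_cosh_sub {t : ℝ} (ht : 0 < t) :
    Differentiable ℝ fun ν : ℝ =>
      ∫ x in Set.Ioi (0 : ℝ), exp (-(t * cosh x) - ν * x) := by
  intro ν₀
  refine (hasDerivAt_integral_of_dominated_loc_of_deriv_le
    (μ := volume.restrict (Set.Ioi 0)) (F := fun ν x => exp (-(t * cosh x) - ν * x))
    (F' := fun ν x => exp (-(t * cosh x) - ν * x) * -x)
    (bound := fun x => exp (-(t * cosh x) - (ν₀ - 2) * x))
    (Metric.ball_mem_nhds ν₀ one_pos) (.of_forall fun ν => by fun_prop)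
    (integrable_exp_neg_mul_cosh_sub ht ν₀).integrableOn (by fun_prop) ?_
    (integrable_exp_neg_mul_cosh_sub ht _).integrableOn
    (.of_forall fun x ν _ => ?_)).2.differentiableAt
  · filter_upwards [ae_restrict_mem measurableSet_Ioi] with x hx ν hν
    have hx : 0 < x := hx
    rw [Metric.mem_ball, dist_eq, abs_lt] at hν
    rw [norm_mul, norm_neg, norm_eq_abs, norm_eq_abs, abs_exp, abs_of_pos hx]
    calc exp (-(t * cosh x) - ν * x) * x
        ≤ exp (-(t * cosh x) - ν * x) * exp x := by
          gcongr
          linarith [add_one_le_exp x]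
      _ ≤ exp (-(t * cosh x) - (ν₀ - 2) * x) := by
          rw [← exp_add, exp_le_exp]
          nlinarith
  · exact ((hasDerivAt_mul_const x (x := ν)).const_sub (-(t * cosh x))).exp

lemma differentiable_integral_exp_mul_cos_mul_cos (t : ℝ) :
    Differentiable ℝ fun ν : ℝ => ∫ x in (0 : ℝ)..π, exp (t * cos x) * cos (ν * x) := by
  intro ν₀
  refine (intervalIntegral.hasDerivAt_integral_of_dominated_loc_of_deriv_le
    (F' := fun ν x => exp (t * cos x) * (-sin (ν * x) * x))
    (bound := fun x => exp (t * cos x) * |x|)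
    Filter.univ_mem (.of_forall fun ν => by fun_prop)
    (Continuous.intervalIntegrable (by fun_prop) _ _) (by fun_prop)
    (.of_forall fun x _ ν _ => ?_) (Continuous.intervalIntegrable (by fun_prop) _ _)
    (.of_forall fun x _ ν _ => ?_)).2.differentiableAt
  · rw [norm_mul, norm_mul, norm_neg, norm_eq_abs, norm_eq_abs, norm_eq_abs, abs_exp]
    gcongr
    exact mul_le_of_le_one_left (abs_nonneg x) (abs_sin_le_one _)
  · exact ((hasDerivAt_mul_const x (x := ν)).cos).const_mul _

/-- The subtraction in `besselI` can be moved out of the interval integral. -/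
lemma besselI_eq_sub (ν t : ℝ) :
    besselI ν t = (1 / π) * (∫ x in (0 : ℝ)..π, exp (t * cos x) * cos (ν * x))
      - (sin (ν * π) / π) * (∫ x in Set.Ioi (0 : ℝ), exp (-(t * cosh x) - ν * x)) := by
  rw [besselI, intervalIntegral.integral_sub (Continuous.intervalIntegrable (by fun_prop) _ _)
    intervalIntegrable_const, intervalIntegral.integral_const, sub_zero, smul_eq_mul]
  field_simp

lemma besselK_eq_add {t : ℝ} (ht : 0 < t) (ν : ℝ) :
    besselK ν t = (1 / 2) * ((∫ x in Set.Ioi (0 : ℝ), exp (-(t * cosh x) - ν * x))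
      + ∫ x in Set.Ioi (0 : ℝ), exp (-(t * cosh x) - -ν * x)) := by
  have hint : Integrable fun x : ℝ => exp (-(t * cosh x) - -ν * x) :=
    integrable_exp_neg_mul_cosh_sub ht (-ν)
  have hneg := integral_comp_neg_Ioi (0 : ℝ) fun x => exp (-(t * cosh x) - -ν * x)
  simp only [cosh_neg, neg_mul_neg, neg_zero] at hneg
  rw [besselK, hneg, intervalIntegral.integral_Iic_add_Ioi hint.integrableOn hint.integrableOn]
  congr 2 with x
  ring_nf

lemma differentiable_besselI {t : ℝ} (ht : 0 < t) : Differentiable ℝ fun ν => besselI ν t := by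
  have hcos := differentiable_integral_exp_mul_cos_mul_cos t
  have hcosh := differentiable_integral_Ioi_exp_neg_mul_cosh_sub ht
  simp only [besselI_eq_sub]
  fun_prop

lemma differentiable_besselK {t : ℝ} (ht : 0 < t) : Differentiable ℝ fun ν => besselK ν t := by
  have hcosh := differentiable_integral_Ioi_exp_neg_mul_cosh_sub ht
  simp only [besselK_eq_add ht]
  exact (hcosh.add (hcosh.comp differentiable_neg)).const_mul _

lemma besselI_neg_sub_besselI {t : ℝ} (ht : 0 < t) (ν : ℝ) :
    besselI (-ν) t - besselI ν t = 2 / π * (sin (ν * π) * besselK ν t) := by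
  simp only [besselI_eq_sub, besselK_eq_add ht, neg_mul ν, cos_neg, sin_neg]
  ring

theorem reflection_deriv_besselI_half (t : ℝ) (ht : 0 < t) (m : ℕ) :
    deriv (fun ν : ℝ => besselI ν t) ((m : ℝ) + 1 / 2)
      + deriv (fun ν : ℝ => besselI ν t) (-((m : ℝ) + 1 / 2))
      = (2 / π) * (-1 : ℝ) ^ (m + 1) * deriv (fun ν : ℝ => besselK ν t) ((m : ℝ) + 1 / 2) := by
  set d : ℝ := (m : ℝ) + 1 / 2 with hd
  have hangle : d * π = π / 2 + m * π := by rw [hd]; ring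
  have hsin : sin (d * π) = (-1) ^ m := by
    rw [hangle, sin_add_nat_mul_pi, sin_pi_div_two, mul_one]
  have hcos : cos (d * π) = 0 := by
    rw [hangle, cos_add_nat_mul_pi, cos_pi_div_two, mul_zero]
  have hI := (differentiable_besselI ht d).hasDerivAt
  have hI' := (differentiable_besselI ht (-d)).hasDerivAt.comp d (hasDerivAt_neg d)
  have hK := (differentiable_besselK ht d).hasDerivAt
  have hrhs := (((hasDerivAt_mul_const π (x := d)).sin).mul hK).const_mul (2 / π)
  have key := (hI'.sub hI).unique
    (hrhs.congr_of_eventuallyEq (.of_forall (besselI_neg_sub_besselI ht)))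
  rw [hsin, hcos] at key
  rw [pow_succ]
  linarith
end
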